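/- arXiv:2311.06502 — 3 statements merged into one kernel-verified Lean document; each statement's English description precedes it below -/
import Mathlib

section
/- Let h > 0 and let z₁, …, z₁₁ ∈ ℝ² be the eleven points h·(0,0), h·(1,0), h·(3,0), h·(4,0), h·(1/2, √3/2), h·(3/2, 3√3/2), h·(7/2, √3/2), h·(5/2, 3√3/2), h·(2, 2√3), h·(3/2, √3/2), h·(5/2, √3/2). If p is a polynomial in two real variables (p ∈ MvPolynomial (Fin 2) ℝ) with total degree at most 3 and p vanishes at all eleven points z₁, …, z₁₁, then p = 0. -/
open MvPolynomial

/-- The eleven honeycomb-mesh vertices contained in the recovery patch `R`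
(the equilateral triangle with vertices `(0,0)`, `(4,0)`, `(2, 2√3)`, before scaling by `h`). -/
noncomputable def patchPoints : Fin 11 → Fin 2 → ℝ :=
  ![![0, 0], ![1, 0], ![3, 0], ![4, 0],
    ![1 / 2, Real.sqrt 3 / 2], ![3 / 2, 3 * Real.sqrt 3 / 2],
    ![7 / 2, Real.sqrt 3 / 2], ![5 / 2, 3 * Real.sqrt 3 / 2],
    ![2, 2 * Real.sqrt 3], ![3 / 2, Real.sqrt 3 / 2], ![5 / 2, Real.sqrt 3 / 2]]

noncomputable def expo (i j : ℕ) : Fin 2 →₀ ℕ := Finsupp.single 0 i + Finsupp.single 1 j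

theorem expo_self (d : Fin 2 →₀ ℕ) : expo (d 0) (d 1) = d := by
  ext k; fin_cases k <;> simp [expo]

theorem expo_degree (d : Fin 2 →₀ ℕ) : (d.sum fun _ e => e) = d 0 + d 1 := by
  rw [Finsupp.sum_fintype _ _ (by simp)]; simp

theorem coeff_expo_zero (p : MvPolynomial (Fin 2) ℝ) (hp : p.totalDegree ≤ 3) (i j : ℕ)
    (hij : 3 < i + j) : coeff (expo i j) p = 0 := by
  by_contra hc
  have h1 := le_totalDegree (mem_support_iff.mpr hc)
  rw [expo_degree] at h1
  simp [expo] at h1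
  omega

theorem eval_expo (p : MvPolynomial (Fin 2) ℝ) (hp : p.totalDegree ≤ 3) (x : Fin 2 → ℝ) :
    eval x p = ∑ q ∈ Finset.range 4 ×ˢ Finset.range 4,
      coeff (expo q.1 q.2) p * (x 0 ^ q.1 * x 1 ^ q.2) := by
  rw [eval_eq']
  refine Finset.sum_of_injOn (fun d => (d 0, d 1)) ?_ ?_ ?_ ?_
  · intro d _ e _ hde
    simp only [Prod.mk.injEq] at hde
    rw [← expo_self d, ← expo_self e, hde.1, hde.2]
  · intro d hd
    have h1 := le_totalDegree hd
    rw [expo_degree] at h1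
    simp only [Finset.coe_product, Set.mem_prod, Finset.mem_coe, Finset.mem_range]
    omega
  · intro q _ hq
    have : coeff (expo q.1 q.2) p = 0 := by
      by_contra hc
      exact hq ⟨expo q.1 q.2, mem_support_iff.mpr hc, by simp [expo]⟩
    rw [this, zero_mul]
  · intro d _
    simp only [expo_self, Fin.prod_univ_two]

/-- A bivariate real polynomial of total degree at most `3` vanishing at the eleven
honeycomb-mesh vertices of the recovery patch (scaled by `h > 0`) is identically zero. -/
theorem vanishing_on_patch_eq_zero (h : ℝ) (hh : 0 < h)
    (p : MvPolynomial (Fin 2) ℝ) (hp : p.totalDegree ≤ 3)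
    (hvan : ∀ j : Fin 11, eval (fun i => h * patchPoints j i) p = 0) :
    p = 0 := by
  have key : ∀ a b : ℝ, eval ![h * a, h * (b * Real.sqrt 3)] p =
      (coeff (expo 0 0) p * (h ^ 0 * Real.sqrt 3 ^ 0)) * (a ^ 0 * b ^ 0) + 
      (coeff (expo 0 1) p * (h ^ 1 * Real.sqrt 3 ^ 1)) * (a ^ 0 * b ^ 1) + 
      (coeff (expo 0 2) p * (h ^ 2 * Real.sqrt 3 ^ 2)) * (a ^ 0 * b ^ 2) + 
      (coeff (expo 0 3) p * (h ^ 3 * Real.sqrt 3 ^ 3)) * (a ^ 0 * b ^ 3) + 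
      (coeff (expo 1 0) p * (h ^ 1 * Real.sqrt 3 ^ 0)) * (a ^ 1 * b ^ 0) + 
      (coeff (expo 1 1) p * (h ^ 2 * Real.sqrt 3 ^ 1)) * (a ^ 1 * b ^ 1) + 
      (coeff (expo 1 2) p * (h ^ 3 * Real.sqrt 3 ^ 2)) * (a ^ 1 * b ^ 2) + 
      (coeff (expo 2 0) p * (h ^ 2 * Real.sqrt 3 ^ 0)) * (a ^ 2 * b ^ 0) + 
      (coeff (expo 2 1) p * (h ^ 3 * Real.sqrt 3 ^ 1)) * (a ^ 2 * b ^ 1) + 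
      (coeff (expo 3 0) p * (h ^ 3 * Real.sqrt 3 ^ 0)) * (a ^ 3 * b ^ 0) := by
    intro a b
    rw [eval_expo p hp]
    simp only [Finset.sum_product, Finset.sum_range_succ, Finset.sum_range_zero]
    rw [coeff_expo_zero p hp 1 3 (by norm_num), coeff_expo_zero p hp 2 2 (by norm_num), coeff_expo_zero p hp 2 3 (by norm_num), coeff_expo_zero p hp 3 1 (by norm_num), coeff_expo_zero p hp 3 2 (by norm_num), coeff_expo_zero p hp 3 3 (by norm_num)]
    simp only [Matrix.cons_val_zero, Matrix.cons_val_one]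
    ring
  have van : ∀ (j : Fin 11) (a b : ℝ), patchPoints j = ![a, b * Real.sqrt 3] →
      eval ![h * a, h * (b * Real.sqrt 3)] p = 0 := by
    intro j a b hj
    rw [← hvan j, hj]
    congr 2
    ext k
    fin_cases k <;> simp
  have e0 := van 0 (0) (0) (by ext k; fin_cases k <;> simp [patchPoints] <;> ring)
  have e1 := van 1 (1) (0) (by ext k; fin_cases k <;> simp [patchPoints] <;> ring)
  have e2 := van 2 (3) (0) (by ext k; fin_cases k <;> simp [patchPoints] <;> ring)
  have e3 := van 3 (4) (0) (by ext k; fin_cases k <;> simp [patchPoints] <;> ring)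
  have e4 := van 4 (1/2) (1/2) (by ext k; fin_cases k <;> simp [patchPoints] <;> ring)
  have e5 := van 5 (3/2) (3/2) (by ext k; fin_cases k <;> simp [patchPoints] <;> ring)
  have e6 := van 6 (7/2) (1/2) (by ext k; fin_cases k <;> simp [patchPoints] <;> ring)
  have e7 := van 7 (5/2) (3/2) (by ext k; fin_cases k <;> simp [patchPoints] <;> ring)
  have e8 := van 8 (2) (2) (by ext k; fin_cases k <;> simp [patchPoints] <;> ring)
  have e9 := van 9 (3/2) (1/2) (by ext k; fin_cases k <;> simp [patchPoints] <;> ring)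
  have e10 := van 10 (5/2) (1/2) (by ext k; fin_cases k <;> simp [patchPoints] <;> ring)
  rw [key] at e0 e1 e2 e3 e4 e5 e6 e7 e8 e9 e10
  have hz : ∀ (c : ℝ) (m n : ℕ), c * (h ^ m * Real.sqrt 3 ^ n) = 0 → c = 0 := by
    intro c m n hc
    have : h ^ m * Real.sqrt 3 ^ n ≠ 0 := by positivity
    exact (mul_eq_zero.mp hc).resolve_right this
  have z00 := hz (coeff (expo 0 0) p) 0 0
  have z01 := hz (coeff (expo 0 1) p) 1 1
  have z02 := hz (coeff (expo 0 2) p) 2 2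
  have z03 := hz (coeff (expo 0 3) p) 3 3
  have z10 := hz (coeff (expo 1 0) p) 1 0
  have z11 := hz (coeff (expo 1 1) p) 2 1
  have z12 := hz (coeff (expo 1 2) p) 3 2
  have z20 := hz (coeff (expo 2 0) p) 2 0
  have z21 := hz (coeff (expo 2 1) p) 3 1
  have z30 := hz (coeff (expo 3 0) p) 3 0
  generalize coeff (expo 0 0) p * (h ^ 0 * Real.sqrt 3 ^ 0) = t00 at *
  generalize coeff (expo 0 1) p * (h ^ 1 * Real.sqrt 3 ^ 1) = t01 at *
  generalize coeff (expo 0 2) p * (h ^ 2 * Real.sqrt 3 ^ 2) = t02 at *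
  generalize coeff (expo 0 3) p * (h ^ 3 * Real.sqrt 3 ^ 3) = t03 at *
  generalize coeff (expo 1 0) p * (h ^ 1 * Real.sqrt 3 ^ 0) = t10 at *
  generalize coeff (expo 1 1) p * (h ^ 2 * Real.sqrt 3 ^ 1) = t11 at *
  generalize coeff (expo 1 2) p * (h ^ 3 * Real.sqrt 3 ^ 2) = t12 at *
  generalize coeff (expo 2 0) p * (h ^ 2 * Real.sqrt 3 ^ 0) = t20 at *
  generalize coeff (expo 2 1) p * (h ^ 3 * Real.sqrt 3 ^ 1) = t21 at *
  generalize coeff (expo 3 0) p * (h ^ 3 * Real.sqrt 3 ^ 0) = t30 at *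
  norm_num at e0 e1 e2 e3 e4 e5 e6 e7 e8 e9 e10
  replace z00 := z00 (by linarith)
  replace z01 := z01 (by linarith)
  replace z02 := z02 (by linarith)
  replace z03 := z03 (by linarith)
  replace z10 := z10 (by linarith)
  replace z11 := z11 (by linarith)
  replace z12 := z12 (by linarith)
  replace z20 := z20 (by linarith)
  replace z21 := z21 (by linarith)
  replace z30 := z30 (by linarith)
  ext d
  rw [coeff_zero, ← expo_self d]
  by_cases hd : 3 < d 0 + d 1
  · exact coeff_expo_zero p hp _ _ hd
  · generalize d 0 = m at *
    generalize d 1 = n at *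
    have hm : m ≤ 3 := by omega
    have hn : n ≤ 3 := by omega
    interval_cases m <;> interval_cases n <;> first | assumption | omega
end

section
/- Let h > 0 and let z₁, …, z₁₁ ∈ ℝ² be the eleven points h·(0,0), h·(1,0), h·(3,0), h·(4,0), h·(1/2, √3/2), h·(3/2, 3√3/2), h·(7/2, √3/2), h·(5/2, 3√3/2), h·(2, 2√3), h·(3/2, √3/2), h·(5/2, √3/2). For any data w : Fin 11 → ℝ, there exists a unique polynomial p in two real variables with total degree at most 3 minimizing the least-squares functional Φ(p) = Σ_{j=1}^{11} (p(z_j) − w_j)² over all polynomials of total degree at most 3. -/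
open MvPolynomial

/-- A polynomial of total degree at most three evaluates as a sum over a `4 × 4` grid. -/
lemma eval_eq_grid (p : MvPolynomial (Fin 2) ℝ) (hp : p.totalDegree ≤ 3) (z : Fin 2 → ℝ) :
    eval z p = ∑ i ∈ Finset.range 4, ∑ j ∈ Finset.range 4,
      p.coeff (Finsupp.single 0 i + Finsupp.single 1 j) * (z 0 ^ i * z 1 ^ j) := by
  classical
  rw [MvPolynomial.eval_eq', ← Finset.sum_product']
  refine Finset.sum_of_injOn (fun d => (d 0, d 1)) ?_ ?_ ?_ ?_
  · intro d _ e _ hde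
    simp only [Prod.mk.injEq] at hde
    ext i
    fin_cases i
    · exact hde.1
    · exact hde.2
  · intro d hd
    have h1 := (MvPolynomial.le_totalDegree (Finset.mem_coe.mp hd)).trans hp
    rw [Finsupp.sum_fintype _ _ (by simp), Fin.sum_univ_two] at h1
    simp only [Finset.coe_product, Set.mem_prod, Finset.mem_coe, Finset.mem_range]
    omega
  · rintro ⟨i, j⟩ _ hij
    have : p.coeff (Finsupp.single 0 i + Finsupp.single 1 j) = 0 := by
      by_contra hc
      apply hij
      refine ⟨_, Finset.mem_coe.mpr (MvPolynomial.mem_support_iff.mpr hc), ?_⟩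
      simp
    simp [this]
  · intro d _
    have : Finsupp.single 0 (d 0) + Finsupp.single 1 (d 1) = d := by
      ext i
      fin_cases i <;> simp
    simp only [this, Fin.prod_univ_two]

lemma coeff_eq_zero_of_large (p : MvPolynomial (Fin 2) ℝ) (hp : p.totalDegree ≤ 3) (i j : ℕ)
    (hij : 3 < i + j) : p.coeff (Finsupp.single 0 i + Finsupp.single 1 j) = 0 := by
  by_contra hc
  have h1 := (MvPolynomial.le_totalDegree (MvPolynomial.mem_support_iff.mpr hc)).trans hp
  rw [Finsupp.sum_fintype _ _ (by simp), Fin.sum_univ_two] at h1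
  simp at h1
  omega

/-- Evaluation at the patch points is injective on cubics. -/
lemma eq_zero_of_eval (h : ℝ) (hh : 0 < h) (p : MvPolynomial (Fin 2) ℝ)
    (hp : p.totalDegree ≤ 3) (h0 : ∀ j, eval (fun i => h * patchPoints j i) p = 0) :
    p = 0 := by
  obtain ⟨c, hc⟩ : ∃ c : ℕ → ℕ → ℝ,
      c = fun i j => p.coeff (Finsupp.single 0 i + Finsupp.single 1 j) := ⟨_, rfl⟩
  have hs : (0 : ℝ) < Real.sqrt 3 := by positivity
  obtain ⟨d, hd⟩ : ∃ d : ℕ → ℕ → ℝ,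
      d = fun i j => c i j * (h ^ i * (h * Real.sqrt 3) ^ j) := ⟨_, rfl⟩
  have hlarge : ∀ i j, 3 < i + j → d i j = 0 := by
    intro i j hij
    rw [hd, hc]
    simp [coeff_eq_zero_of_large p hp i j hij]
  have key : ∀ (a b : ℝ), eval ![h * a, h * (b * Real.sqrt 3)] p = 0 →
      d 0 0 + d 0 1 * b + d 0 2 * b ^ 2 + d 0 3 * b ^ 3 + d 1 0 * a + d 1 1 * (a * b)
        + d 1 2 * (a * b ^ 2) + d 2 0 * a ^ 2 + d 2 1 * (a ^ 2 * b) + d 3 0 * a ^ 3 = 0 := by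
    intro a b hab
    rw [eval_eq_grid p hp] at hab
    have h2 : ∑ i ∈ Finset.range 4, ∑ j ∈ Finset.range 4, d i j * (a ^ i * b ^ j) = 0 := by
      rw [← hab]
      refine Finset.sum_congr rfl fun i _ => Finset.sum_congr rfl fun j _ => ?_
      rw [hd, hc]
      simp only [Matrix.cons_val_zero, Matrix.cons_val_one, mul_pow]
      ring
    simp only [Finset.sum_range_succ, Finset.sum_range_zero] at h2
    rw [hlarge 1 3 (by norm_num), hlarge 2 2 (by norm_num), hlarge 2 3 (by norm_num),
      hlarge 3 1 (by norm_num), hlarge 3 2 (by norm_num), hlarge 3 3 (by norm_num)] at h2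
    linarith
  have pt : ∀ (j : Fin 11) (a b : ℝ), patchPoints j 0 = a → patchPoints j 1 = b * Real.sqrt 3 →
      eval ![h * a, h * (b * Real.sqrt 3)] p = 0 := by
    intro j a b ha hb
    rw [← h0 j]
    congr 2
    funext i
    fin_cases i
    · simp [ha]
    · simp [hb]
  have e0 := key _ _ (pt 0 0 0 (by simp [patchPoints]) (by simp [patchPoints]))
  have e1 := key _ _ (pt 1 1 0 (by simp [patchPoints]) (by simp [patchPoints]))
  have e2 := key _ _ (pt 2 3 0 (by simp [patchPoints]) (by simp [patchPoints]))
  have e3 := key _ _ (pt 3 4 0 (by simp [patchPoints]) (by simp [patchPoints]))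
  have e4 := key _ _ (pt 4 (1/2) (1/2) (by simp [patchPoints]) (by simp [patchPoints]; ring))
  have e5 := key _ _ (pt 5 (3/2) (3/2) (by simp [patchPoints]) (by simp [patchPoints]; ring))
  have e6 := key _ _ (pt 6 (7/2) (1/2) (by simp [patchPoints]) (by simp [patchPoints]; ring))
  have e7 := key _ _ (pt 7 (5/2) (3/2) (by simp [patchPoints]) (by simp [patchPoints]; ring))
  have e8 := key _ _ (pt 8 2 2 (by simp [patchPoints]) (by simp [patchPoints]))
  have e9 := key _ _ (pt 9 (3/2) (1/2) (by simp [patchPoints]) (by simp [patchPoints]; ring))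
  have e10 := key _ _ (pt 10 (5/2) (1/2) (by simp [patchPoints]) (by simp [patchPoints]; ring))
  norm_num at e0 e1 e2 e3 e4 e5 e6 e7 e8 e9 e10
  have d00 : d 0 0 = 0 := by linarith
  have d10 : d 1 0 = 0 := by linarith
  have d20 : d 2 0 = 0 := by linarith
  have d30 : d 3 0 = 0 := by linarith
  have d01 : d 0 1 = 0 := by linarith
  have d02 : d 0 2 = 0 := by linarith
  have d03 : d 0 3 = 0 := by linarith
  have d11 : d 1 1 = 0 := by linarith
  have d12 : d 1 2 = 0 := by linarith
  have d21 : d 2 1 = 0 := by linarith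
  have hall : ∀ i j, d i j = 0 := by
    intro i j
    by_cases hij : 3 < i + j
    · exact hlarge i j hij
    · have hi : i ≤ 3 := by omega
      have hj : j ≤ 3 := by omega
      interval_cases i <;> interval_cases j <;> first | assumption | omega
  ext m
  have hm : Finsupp.single 0 (m 0) + Finsupp.single 1 (m 1) = m := by
    ext i
    fin_cases i <;> simp
  have h3 := hall (m 0) (m 1)
  rw [hd, hc] at h3
  simp only [hm] at h3
  have hne : h ^ m 0 * (h * Real.sqrt 3) ^ m 1 ≠ 0 := by positivity
  simpa using (mul_eq_zero.mp h3).resolve_right hne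

/-- For any data `w` at the eleven honeycomb-mesh vertices of the recovery patch
(scaled by `h > 0`), there is a unique bivariate real polynomial of total degree at most `3`
minimizing the least-squares functional `Φ(p) = Σⱼ (p(zⱼ) − wⱼ)²` over all polynomials of
total degree at most `3`. -/
theorem exists_unique_least_squares_lift (h : ℝ) (hh : 0 < h) (w : Fin 11 → ℝ) :
    ∃! p : MvPolynomial (Fin 2) ℝ, p.totalDegree ≤ 3 ∧
      ∀ q : MvPolynomial (Fin 2) ℝ, q.totalDegree ≤ 3 →
        (∑ j : Fin 11, (eval (fun i => h * patchPoints j i) p - w j) ^ 2) ≤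
          ∑ j : Fin 11, (eval (fun i => h * patchPoints j i) q - w j) ^ 2 := by
  classical
  let z : Fin 11 → Fin 2 → ℝ := fun j i => h * patchPoints j i
  let V := MvPolynomial.restrictTotalDegree (Fin 2) ℝ 3
  let L : MvPolynomial (Fin 2) ℝ →ₗ[ℝ] EuclideanSpace ℝ (Fin 11) :=
    { toFun := fun p => WithLp.toLp 2 fun j => eval (z j) p
      map_add' := by intro p q; ext j; simp
      map_smul' := by intro r p; ext j; simp }
  let K : Submodule ℝ (EuclideanSpace ℝ (Fin 11)) := V.map L
  let W : EuclideanSpace ℝ (Fin 11) := WithLp.toLp 2 w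
  have hΦ : ∀ p, ∑ j : Fin 11, (eval (fun i => h * patchPoints j i) p - w j) ^ 2
      = ‖W - L p‖ ^ 2 := by
    intro p
    rw [EuclideanSpace.real_norm_sq_eq]
    refine Finset.sum_congr rfl fun j _ => ?_
    change _ = (w j - eval (fun i => h * patchPoints j i) p) ^ 2
    ring
  obtain ⟨p, hpV, hpL⟩ : ∃ p ∈ V, L p = K.starProjection W :=
    Submodule.mem_map.mp (K.starProjection_apply_mem W)
  have hp : p.totalDegree ≤ 3 := (MvPolynomial.mem_restrictTotalDegree _ _ _).mp hpV
  have hmin : ∀ q : MvPolynomial (Fin 2) ℝ, q.totalDegree ≤ 3 →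
      (∑ j : Fin 11, (eval (fun i => h * patchPoints j i) p - w j) ^ 2) ≤
        ∑ j : Fin 11, (eval (fun i => h * patchPoints j i) q - w j) ^ 2 := by
    intro q hq
    rw [hΦ, hΦ, hpL]
    have hqK : L q ∈ K := Submodule.mem_map_of_mem
      ((MvPolynomial.mem_restrictTotalDegree _ _ _).mpr hq)
    have hle : ‖W - K.starProjection W‖ ≤ ‖W - L q‖ := by
      rw [Submodule.starProjection_minimal]
      exact ciInf_le ⟨0, by rintro _ ⟨x, rfl⟩; exact norm_nonneg _⟩ (⟨L q, hqK⟩ : K)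
    gcongr
  refine ⟨p, ⟨hp, hmin⟩, ?_⟩
  rintro q ⟨hq, hqmin⟩
  have hsub : (q - p).totalDegree ≤ 3 :=
    (MvPolynomial.totalDegree_sub _ _).trans (max_le hq hp)
  let r : MvPolynomial (Fin 2) ℝ := (1 / 2 : ℝ) • (q + p)
  have hr : r.totalDegree ≤ 3 := (MvPolynomial.totalDegree_smul_le _ _).trans
    ((MvPolynomial.totalDegree_add _ _).trans (max_le hq hp))
  have h1 := hmin r hr
  have h2 := hqmin r hr
  have hpar : ∑ j : Fin 11, (eval (fun i => h * patchPoints j i) r - w j) ^ 2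
      = (1 / 2) * ∑ j : Fin 11, (eval (fun i => h * patchPoints j i) q - w j) ^ 2
      + (1 / 2) * ∑ j : Fin 11, (eval (fun i => h * patchPoints j i) p - w j) ^ 2
      - (1 / 4) * ∑ j : Fin 11, (eval (fun i => h * patchPoints j i) (q - p)) ^ 2 := by
    rw [Finset.mul_sum, Finset.mul_sum, Finset.mul_sum, ← Finset.sum_add_distrib,
      ← Finset.sum_sub_distrib]
    refine Finset.sum_congr rfl fun j _ => ?_
    simp only [r, MvPolynomial.smul_eval, map_add, map_sub]
    ring
  have hnn : ∀ j ∈ (Finset.univ : Finset (Fin 11)),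
      0 ≤ (eval (fun i => h * patchPoints j i) (q - p)) ^ 2 := fun j _ => sq_nonneg _
  have hz : ∑ j : Fin 11, (eval (fun i => h * patchPoints j i) (q - p)) ^ 2 = 0 :=
    le_antisymm (by linarith) (Finset.sum_nonneg hnn)
  have hz' := (Finset.sum_eq_zero_iff_of_nonneg hnn).mp hz
  exact sub_eq_zero.mp (eq_zero_of_eval h hh _ hsub fun j =>
    pow_eq_zero_iff (two_ne_zero) |>.mp (hz' j (Finset.mem_univ j)))
end

section
/- Let h > 0 and let z₁, …, z₁₁ ∈ ℝ² be the eleven points h·(0,0), h·(1,0), h·(3,0), h·(4,0), h·(1/2, √3/2), h·(3/2, 3√3/2), h·(7/2, √3/2), h·(5/2, 3√3/2), h·(2, 2√3), h·(3/2, √3/2), h·(5/2, √3/2). Let q be a polynomial in two real variables with total degree at most 3, and set w_j = q(z_j) for j = 1, …, 11. Then for every polynomial p of total degree at most 3 with p ≠ q one has Σ_{j=1}^{11} (p(z_j) − w_j)² > 0 = Σ_{j=1}^{11} (q(z_j) − w_j)²; that is, q is the unique minimizer of the least-squares functional, so the least-squares lifting operator reproduces all polynomials of total degree at most 3. -/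
open MvPolynomial


/-- Evaluation of a polynomial of total degree at most 3 in terms of its ten coefficients. -/
lemma exists_coeffs (r : MvPolynomial (Fin 2) ℝ) (hr : r.totalDegree ≤ 3) :
    ∃ c : ℕ → ℕ → ℝ, (∀ x : Fin 2 → ℝ, eval x r =
      c 0 0 + c 1 0 * x 0 + c 0 1 * x 1 + c 2 0 * x 0 ^ 2 + c 1 1 * (x 0 * x 1) + c 0 2 * x 1 ^ 2
      + c 3 0 * x 0 ^ 3 + c 2 1 * (x 0 ^ 2 * x 1) + c 1 2 * (x 0 * x 1 ^ 2) + c 0 3 * x 1 ^ 3) ∧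
      (c 0 0 = 0 → c 1 0 = 0 → c 0 1 = 0 → c 2 0 = 0 → c 1 1 = 0 → c 0 2 = 0 → c 3 0 = 0 →
        c 2 1 = 0 → c 1 2 = 0 → c 0 3 = 0 → r = 0) := by
  classical
  let e : ℕ × ℕ → (Fin 2 →₀ ℕ) := fun k => Finsupp.single 0 k.1 + Finsupp.single 1 k.2
  have e0 : ∀ k, e k 0 = k.1 := fun k => by simp [e]
  have e1 : ∀ k, e k 1 = k.2 := fun k => by simp [e]
  have einj : Function.Injective e := by
    intro k l hkl
    ext
    · rw [← e0, ← e0 l, hkl]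
    · rw [← e1, ← e1 l, hkl]
  have esurj : ∀ d : Fin 2 →₀ ℕ, e (d 0, d 1) = d := by
    intro d
    ext i
    fin_cases i
    · exact e0 _
    · exact e1 _
  have hz : ∀ d : Fin 2 →₀ ℕ, 3 < d 0 + d 1 → r.coeff d = 0 := by
    intro d hd
    by_contra hne
    have h1 := le_totalDegree (mem_support_iff.mpr hne)
    rw [Finsupp.sum_fintype _ _ (by simp)] at h1
    simp at h1
    omega
  have hz2 : ∀ i j, 3 < i + j → r.coeff (e (i, j)) = 0 := by
    intro i j hij
    apply hz
    rw [e0, e1]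
    exact hij
  refine ⟨fun i j => r.coeff (e (i, j)), ?_, ?_⟩
  · intro x
    have hsub : r.support ⊆ (Finset.range 4 ×ˢ Finset.range 4).image e := by
      intro d hd
      have : ¬ 3 < d 0 + d 1 := fun hlt => mem_support_iff.mp hd (hz d hlt)
      rw [Finset.mem_image]
      refine ⟨(d 0, d 1), ?_, esurj d⟩
      simp
      omega
    rw [eval_eq', Finset.sum_subset hsub (by
      intro d _ hd
      rw [notMem_support_iff.mp hd, zero_mul]),
      Finset.sum_image (fun a _ b _ hab => einj hab), Finset.sum_product]
    simp only [Finset.sum_range_succ, Finset.sum_range_zero, Fin.prod_univ_two, e0, e1]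
    rw [hz2 1 3 (by norm_num), hz2 2 2 (by norm_num), hz2 2 3 (by norm_num), hz2 3 1 (by norm_num),
      hz2 3 2 (by norm_num), hz2 3 3 (by norm_num)]
    ring
  · intro h1 h2 h3 h4 h5 h6 h7 h8 h9 h10
    ext d
    rw [coeff_zero]
    by_cases hd : 3 < d 0 + d 1
    · exact hz d hd
    · rw [← esurj d]
      generalize d 0 = i at *
      generalize d 1 = j at *
      have hi : i ≤ 3 := by omega
      have hj : j ≤ 3 := by omega
      interval_cases i <;> interval_cases j <;> first | assumption | omega

/-- Unisolvence: a cubic vanishing at the eleven points is zero. -/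
lemma eq_zero_of_vanish (h : ℝ) (hh : 0 < h) (r : MvPolynomial (Fin 2) ℝ)
    (hr : r.totalDegree ≤ 3)
    (hv : ∀ j : Fin 11, eval (fun i => h * patchPoints j i) r = 0) : r = 0 := by
  obtain ⟨c, hc, h0⟩ := exists_coeffs r hr
  have hs : (0 : ℝ) < Real.sqrt 3 := by positivity
  have E0 := hv 0
  have E1 := hv 1
  have E2 := hv 2
  have E3 := hv 3
  have E4 := hv 4
  have E5 := hv 5
  have E6 := hv 6
  have E7 := hv 7
  have E8 := hv 8
  have E9 := hv 9
  rw [hc] at E0 E1 E2 E3 E4 E5 E6 E7 E8 E9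
  simp [patchPoints] at E0 E1 E2 E3 E4 E5 E6 E7 E8 E9
  generalize Real.sqrt 3 = s at *
  have key : ∀ i j, c i j * h ^ (i + j) * s ^ j = 0 → c i j = 0 := by
    intro i j hij
    have a1 : h ^ (i + j) ≠ 0 := by positivity
    have a2 : s ^ j ≠ 0 := by positivity
    simpa [a1, a2, hh.ne', hs.ne'] using hij
  apply h0 <;> apply key <;> ring_nf <;> linarith

/-- P₃-reproduction of the least-squares lift: if the data `w` are the values of a polynomial
`q` of total degree at most `3` at the eleven patch vertices (scaled by `h > 0`), then the
least-squares functional vanishes at `q` and is strictly positive at every other polynomial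
of total degree at most `3`; i.e. `q` is the unique minimizer. -/
theorem least_squares_lift_reproduces_P3 (h : ℝ) (hh : 0 < h)
    (q : MvPolynomial (Fin 2) ℝ) (hq : q.totalDegree ≤ 3)
    (w : Fin 11 → ℝ) (hw : ∀ j : Fin 11, w j = eval (fun i => h * patchPoints j i) q) :
    (∑ j : Fin 11, (eval (fun i => h * patchPoints j i) q - w j) ^ 2) = 0 ∧
      ∀ p : MvPolynomial (Fin 2) ℝ, p.totalDegree ≤ 3 → p ≠ q →
        0 < ∑ j : Fin 11, (eval (fun i => h * patchPoints j i) p - w j) ^ 2 := by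
  refine ⟨by simp [hw], ?_⟩
  intro p hp hpq
  have hnn : 0 ≤ ∑ j : Fin 11, (eval (fun i => h * patchPoints j i) p - w j) ^ 2 :=
    Finset.sum_nonneg fun j _ => sq_nonneg _
  refine lt_of_le_of_ne hnn fun h0 => hpq ?_
  have hall := (Finset.sum_eq_zero_iff_of_nonneg (fun j _ => sq_nonneg _)).mp h0.symm
  refine sub_eq_zero.mp (eq_zero_of_vanish h hh (p - q)
    ((totalDegree_sub p q).trans (max_le hp hq)) fun j => ?_)
  have := hall j (Finset.mem_univ j)
  rw [map_sub, ← hw]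
  exact pow_eq_zero_iff (two_ne_zero) |>.mp this
end
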